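/- Every 10-vertex graph with at least 13 triangles contains a subgraph isomorphic to the suspension of P4. -/

import Mathlib

/-- `H` is contained in `G` as a (not necessarily induced) subgraph:
there is an injective map of vertices carrying edges of `H` to edges of `G`. -/
def Contains {α β : Type*} (H : SimpleGraph α) (G : SimpleGraph β) : Prop :=
  ∃ f : α → β, Function.Injective f ∧ ∀ ⦃a b⦄, H.Adj a b → G.Adj (f a) (f b)

/-- The suspension `P̂₄` of the path on 4 vertices: a new apex vertex `none`
is joined to all four vertices of `P₄`. -/
def hatP4 : SimpleGraph (Option (Fin 4)) :=
  SimpleGraph.fromRel (fun a b =>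
    (∃ i j, a = some i ∧ b = some j ∧ (SimpleGraph.pathGraph 4).Adj i j) ∨ a = none)

/-- The number of triangles (3-cliques) of a graph. -/
noncomputable def triangleCount {V : Type*} (G : SimpleGraph V) : ℕ :=
  (G.cliqueSet 3).ncard

open Finset

/-- `G` has no copy of the suspension of the path on 4 vertices. -/
def HatFree {V : Type*} (G : SimpleGraph V) : Prop :=
  ∀ ⦃v p q r s : V⦄, G.Adj v p → G.Adj v q → G.Adj v r → G.Adj v s →
    G.Adj p q → G.Adj q r → G.Adj r s → p ≠ r → p ≠ s → q ≠ s → False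

theorem hatFree_of_not_contains {V : Type*} {G : SimpleGraph V} (h : ¬ Contains hatP4 G) :
    HatFree G := by
  intro v p q r s vp vq vr vs pq qr rs hpr hps hqs
  apply h
  refine ⟨fun o => o.elim v ![p, q, r, s], ?_, ?_⟩
  · have := vp.ne
    have := vq.ne
    have := vr.ne
    have := vs.ne
    have := pq.ne
    have := qr.ne
    have := rs.ne
    rintro (_ | i) (_ | j) hij
    · rfl
    · fin_cases j <;> simp_all
    · fin_cases i <;> simp_all
    · fin_cases i <;> fin_cases j <;> simp_all
  · rintro (_ | i) (_ | j) hij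
    · simp at hij
    · fin_cases j <;> simp [*]
    · fin_cases i <;> simp [*, G.adj_comm]
    · simp only [hatP4, SimpleGraph.fromRel_adj, SimpleGraph.pathGraph_adj] at hij
      fin_cases i <;> fin_cases j <;> simp_all [G.adj_comm]

section Structure

variable {V : Type*} [DecidableEq V] {G : SimpleGraph V}

theorem HatFree.eq_of_adj_of_adj (hG : HatFree G) {Q : Finset V} (hQ : G.IsNClique 4 Q)
    {x a b : V} (hx : x ∉ Q) (ha : a ∈ Q) (hb : b ∈ Q) (xa : G.Adj x a) (xb : G.Adj x b) :
    a = b := by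
  by_contra hab
  have hcard : #((Q.erase a).erase b) = 2 := by
    rw [card_erase_of_mem (by simp [hb, Ne.symm hab]), card_erase_of_mem ha, hQ.card_eq]
  obtain ⟨c, d, hcd, h⟩ := card_eq_two.1 hcard
  have hc : c ∈ (Q.erase a).erase b := by simp [h]
  have hd : d ∈ (Q.erase a).erase b := by simp [h]
  simp only [mem_erase] at hc hd
  obtain ⟨hcb, hca, hcQ⟩ := hc
  obtain ⟨hdb, hda, hdQ⟩ := hd
  have adj := fun {u v : V} (hu : u ∈ Q) (hv : v ∈ Q) (huv : u ≠ v) => hQ.isClique hu hv huv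
  exact hG xa.symm (adj ha hb hab) (adj ha hcQ hca.symm) (adj ha hdQ hda.symm) xb
    (adj hb hcQ hcb.symm) (adj hcQ hdQ hcd) (fun h => hx (h ▸ hcQ)) (fun h => hx (h ▸ hdQ))
    hdb.symm

theorem HatFree.filter_adj_eq [DecidableRel G.Adj] (hG : HatFree G) {Q : Finset V}
    (hQ : G.IsNClique 4 Q) {x a : V} (hx : x ∉ Q) (ha : a ∈ Q) (xa : G.Adj x a) :
    {y ∈ Q | G.Adj x y} = {a} := by
  ext y
  simp only [mem_filter, mem_singleton]
  constructor
  · rintro ⟨hy, xy⟩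
    exact hG.eq_of_adj_of_adj hQ hx hy ha xy xa
  · rintro rfl
    exact ⟨ha, xa⟩

theorem HatFree.subset_of_mem (hG : HatFree G) {Q T : Finset V} {n : ℕ} (hQ : G.IsNClique 4 Q)
    (hT : G.IsNClique n T) {a b : V} (hab : a ≠ b) (ha : a ∈ T) (hb : b ∈ T) (haQ : a ∈ Q)
    (hbQ : b ∈ Q) : T ⊆ Q := by
  intro x hx
  by_contra hxQ
  exact hab (hG.eq_of_adj_of_adj hQ hxQ haQ hbQ
    (hT.isClique hx ha (fun h => hxQ (h ▸ haQ))) (hT.isClique hx hb (fun h => hxQ (h ▸ hbQ))))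

theorem HatFree.card_inter_le_one (hG : HatFree G) {Q T : Finset V} {n : ℕ}
    (hQ : G.IsNClique 4 Q) (hT : G.IsNClique n T) (h : ¬ T ⊆ Q) : #(T ∩ Q) ≤ 1 := by
  rw [card_le_one]
  intro a ha b hb
  by_contra hab
  rw [mem_inter] at ha hb
  exact h (hG.subset_of_mem hQ hT hab ha.1 hb.1 ha.2 hb.2)

/-- In a triangle outside all 4-cliques, of two edges one lies in no further triangle. -/
theorem HatFree.unique_common_neighbor_or (hG : HatFree G) {x y z : V} (xy : G.Adj x y)
    (xz : G.Adj x z) (yz : G.Adj y z) (hK : ∀ Q, G.IsNClique 4 Q → ¬ {x, y, z} ⊆ Q) :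
    (∀ w, G.Adj w x → G.Adj w y → w = z) ∨ (∀ w, G.Adj w x → G.Adj w z → w = y) := by
  by_contra! h
  obtain ⟨⟨d, dx, dy, dz⟩, e, ex, ez, ey⟩ := h
  by_cases hde : d = e
  · subst hde
    refine hK {d, x, y, z} ?_ (by simp)
    refine (SimpleGraph.is3Clique_iff.2 ⟨x, y, z, xy, xz, yz, rfl⟩).insert ?_
    simp [dx, dy, ez]
  · exact hG dx.symm xy xz ex.symm dy yz ez.symm dz hde ey.symm

theorem eq_of_unique_common_neighbor {a b c : V}
    (h : ∀ w, G.Adj w a → G.Adj w b → w = c) {T : Finset V} (hT : G.IsNClique 3 T)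
    (ha : a ∈ T) (hb : b ∈ T) : T = {a, b, c} := by
  have hsub : T ⊆ {a, b, c} := by
    intro w hw
    simp only [mem_insert, mem_singleton]
    by_contra! hne
    exact hne.2.2 (h w (hT.isClique hw ha hne.1) (hT.isClique hw hb hne.2.1))
  exact eq_of_subset_of_card_le hsub (hT.card_eq ▸ card_le_three)

/-- A triangle outside all 4-cliques has a vertex both of whose edges lie in no other triangle. -/
theorem HatFree.exists_apex (hG : HatFree G) {T : Finset V} (hT : G.IsNClique 3 T)
    (hK : ∀ Q, G.IsNClique 4 Q → ¬ T ⊆ Q) :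
    ∃ a ∈ T, ∀ b ∈ T, b ≠ a → ∀ T', G.IsNClique 3 T' → a ∈ T' → b ∈ T' → T' = T := by
  obtain ⟨x, y, z, xy, xz, yz, rfl⟩ := SimpleGraph.is3Clique_iff.1 hT
  have apex : ∀ a b c : V, (∀ w, G.Adj w a → G.Adj w b → w = c) →
      (∀ w, G.Adj w a → G.Adj w c → w = b) → ({x, y, z} : Finset V) = {a, b, c} →
      ∃ a ∈ ({x, y, z} : Finset V), ∀ b ∈ ({x, y, z} : Finset V), b ≠ a →
        ∀ T', G.IsNClique 3 T' → a ∈ T' → b ∈ T' → T' = {x, y, z} := by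
    intro a b c h1 h2 h
    rw [h]
    refine ⟨a, by simp, fun d hd hda T' hT' ha hd' => ?_⟩
    simp only [mem_insert, mem_singleton] at hd
    rcases hd with rfl | rfl | rfl
    · exact absurd rfl hda
    · exact eq_of_unique_common_neighbor h1 hT' ha hd'
    · rw [eq_of_unique_common_neighbor h2 hT' ha hd', pair_comm]
  have e1 : ({x, y, z} : Finset V) = {y, x, z} := by ext; simp; tauto
  have e2 : ({x, y, z} : Finset V) = {z, x, y} := by ext; simp; tauto
  have h1 := hG.unique_common_neighbor_or xy xz yz hK
  have h2 := hG.unique_common_neighbor_or xy.symm yz xz (e1 ▸ hK)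
  have h3 := hG.unique_common_neighbor_or xz.symm yz.symm xy (e2 ▸ hK)
  have sw : ∀ {a b c : V}, (∀ w, G.Adj w a → G.Adj w b → w = c) →
      (∀ w, G.Adj w b → G.Adj w a → w = c) := fun h w u v => h w v u
  rcases h1 with h1 | h1
  · rcases h3 with h3 | h3
    · exact apex x y z h1 (sw h3) rfl
    · exact apex y x z (sw h1) (sw h3) e1
  · rcases h2 with h2 | h2
    · exact apex x y z (sw h2) h1 rfl
    · exact apex z x y (sw h1) (sw h2) e2

/-- The Mantel bound, counting ordered pairs inside a finite set. -/
theorem two_mul_sum_adj_le_sq {V : Type*} [DecidableEq V] (R : V → V → Prop) [DecidableRel R]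
    (hs : ∀ x y, R x y → R y x) (ht : ∀ x y z, R x y → R y z → R x z → False) (W : Finset V) :
    2 * ∑ x ∈ W, ∑ y ∈ W, (if R x y then 1 else 0) ≤ #W ^ 2 := by
  induction W using Finset.strongInduction with
  | H W ih =>
    by_cases h : ∃ a ∈ W, ∃ b ∈ W, R a b
    · obtain ⟨a, ha, b, hb, hab⟩ := h
      have hne : a ≠ b := fun h => ht a b b hab (h ▸ hab) hab
      have hirr : ∀ x, ¬ R x x := fun x hx => ht x x x hx hx hx
      obtain ⟨U, hUa, hUb, rfl⟩ : ∃ U, a ∉ insert b U ∧ b ∉ U ∧ W = insert a (insert b U) := by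
        refine ⟨(W.erase a).erase b, ?_, ?_, ?_⟩
        · simp [hne]
        · simp
        · rw [insert_erase (by simp [hb, hne.symm]), insert_erase ha]
      have hU := ih U ((ssubset_insert hUb).trans (ssubset_insert hUa))
      have hcross : ∑ x ∈ U, (if R x a then 1 else 0) + ∑ x ∈ U, (if R x b then 1 else 0) ≤ #U := by
        rw [← sum_add_distrib, card_eq_sum_ones]
        refine sum_le_sum fun x _ => ?_
        by_cases h1 : R x a <;> by_cases h2 : R x b <;> simp [h1, h2]
        exact ht x a b h1 hab h2
      have hsymm : ∀ x y, R x y ↔ R y x := fun x y => ⟨hs x y, hs y x⟩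
      have ea : ∑ x ∈ U, (if R a x then 1 else 0) = ∑ x ∈ U, (if R x a then 1 else 0) :=
        sum_congr rfl fun x _ => by simp only [hsymm a x]
      have eb : ∑ x ∈ U, (if R b x then 1 else 0) = ∑ x ∈ U, (if R x b then 1 else 0) :=
        sum_congr rfl fun x _ => by simp only [hsymm b x]
      simp only [sum_insert hUa, sum_insert hUb, sum_add_distrib, card_insert_of_notMem hUa,
        card_insert_of_notMem hUb, hirr, hab, hs a b hab, if_true, if_false, ea, eb]
      nlinarith
    · push Not at h
      rw [sum_eq_zero fun x hx => sum_eq_zero fun y hy => if_neg (h x hx y hy)]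
      exact Nat.zero_le _

theorem HatFree.card_inter_le_one_of_ne (hG : HatFree G) {Q Q' : Finset V}
    (hQ : G.IsNClique 4 Q) (hQ' : G.IsNClique 4 Q') (hne : Q' ≠ Q) : #(Q' ∩ Q) ≤ 1 :=
  hG.card_inter_le_one hQ hQ' fun h =>
    hne (eq_of_subset_of_card_le h (by rw [hQ.card_eq, hQ'.card_eq]))

/-- A triangle through two vertices outside a 4-clique `Q` and a vertex of `Q`. -/
theorem HatFree.eq_insert_filter [DecidableRel G.Adj] (hG : HatFree G) {Q T : Finset V}
    (hQ : G.IsNClique 4 Q) (hT : G.IsNClique 3 T) {x y z : V} (hxQ : x ∉ Q) (hzQ : z ∈ Q) (hxy : x ≠ y)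
    (hyz : y ≠ z) (hx : x ∈ T) (hy : y ∈ T) (hz : z ∈ T) : T = {x, y} ∪ {w ∈ Q | G.Adj x w} := by
  have hxz : x ≠ z := fun h => hxQ (h ▸ hzQ)
  rw [hG.filter_adj_eq hQ hxQ hzQ (hT.isClique hx hz hxz)]
  refine (eq_of_subset_of_card_le ?_ ?_).symm
  · intro w hw
    simp only [mem_union, mem_insert, mem_singleton] at hw
    rcases hw with (rfl | rfl) | rfl <;> assumption
  · rw [hT.card_eq, insert_union, ← insert_eq, card_eq_three.2 ⟨x, y, z, hxy, hxz, hyz, rfl⟩]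

/-- A triangle inside neither of two 4-cliques meets their complement. -/
theorem HatFree.exists_mem_notMem (hG : HatFree G) {Q Q' T : Finset V} (hQ : G.IsNClique 4 Q)
    (hQ' : G.IsNClique 4 Q') (hT : G.IsNClique 3 T) (h : ¬ T ⊆ Q) (h' : ¬ T ⊆ Q') :
    ∃ x ∈ T, x ∉ Q ∧ x ∉ Q' := by
  by_contra! hc
  have hsub : T ⊆ (T ∩ Q) ∪ (T ∩ Q') := fun x hx => by
    by_cases hxQ : x ∈ Q
    · simp [hx, hxQ]
    · simp [hx, hc x hx hxQ]
  have h1 := card_le_card hsub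
  have h2 := card_union_le (T ∩ Q) (T ∩ Q')
  have h3 := hG.card_inter_le_one hQ hT h
  have h4 := hG.card_inter_le_one hQ' hT h'
  have := hT.card_eq
  omega

/-- A triangle-free edge set with two edges from each triangle outside all 4-cliques. -/
theorem HatFree.exists_triangleFree_pairs (hG : HatFree G) (F : Finset (Finset V))
    (hF : ∀ T ∈ F, G.IsNClique 3 T) (hK : ∀ T ∈ F, ∀ Q, G.IsNClique 4 Q → ¬ T ⊆ Q) :
    ∃ S : Finset (V × V), #S = 4 * #F ∧ (∀ x y, (x, y) ∈ S → (y, x) ∈ S) ∧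
      (∀ x y, (x, y) ∈ S → G.Adj x y ∧ ∃ T ∈ F, x ∈ T ∧ y ∈ T) ∧
      (∀ x y z, (x, y) ∈ S → (y, z) ∈ S → (x, z) ∈ S → False) := by
  obtain rfl | ⟨T₀, hT₀⟩ := F.eq_empty_or_nonempty
  · exact ⟨∅, by simp⟩
  have : Nonempty V := ⟨(hG.exists_apex (hF T₀ hT₀) (hK T₀ hT₀)).choose⟩
  choose! a ha hapex using fun T hT => hG.exists_apex (hF T hT) (hK T hT)
  have key : ∀ T ∈ F, ∀ x y, (x = a T ∧ y ∈ T.erase (a T)) ∨ (x ∈ T.erase (a T) ∧ y = a T) →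
      x ≠ y ∧ x ∈ T ∧ y ∈ T ∧ ∀ T', G.IsNClique 3 T' → x ∈ T' → y ∈ T' → T' = T := by
    intro T hT x y h
    simp only [mem_erase] at h
    rcases h with ⟨rfl, hne, hy⟩ | ⟨⟨hne, hx⟩, rfl⟩
    · exact ⟨hne.symm, ha T hT, hy, fun T' hT' => hapex T hT y hy hne T' hT'⟩
    · exact ⟨hne, hx, ha T hT, fun T' hT' h1 h2 => hapex T hT x hx hne T' hT' h2 h1⟩
  have hmem : ∀ x y, (x, y) ∈ F.biUnion (fun T => ({a T} ×ˢ T.erase (a T)) ∪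
      (T.erase (a T) ×ˢ {a T})) ↔ ∃ T ∈ F, (x = a T ∧ y ∈ T.erase (a T)) ∨
        (x ∈ T.erase (a T) ∧ y = a T) := by
    intro x y
    simp only [mem_biUnion, mem_union, mem_product, mem_singleton]
  refine ⟨F.biUnion (fun T => ({a T} ×ˢ T.erase (a T)) ∪ (T.erase (a T) ×ˢ {a T})), ?_, ?_, ?_, ?_⟩
  · rw [card_biUnion, sum_const_nat (m := 4), mul_comm]
    · intro T hT
      rw [card_union_of_disjoint, card_product, card_product, card_erase_of_mem (ha T hT),
        (hF T hT).card_eq, card_singleton]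
      rw [disjoint_left]
      rintro ⟨x, y⟩ h1 h2
      simp only [mem_product, mem_singleton, mem_erase] at h1 h2
      exact h2.1.1 h1.1
    · intro T hT T' hT' hne
      rw [Function.onFun, disjoint_left]
      rintro ⟨x, y⟩ h1 h2
      simp only [mem_union, mem_product, mem_singleton] at h1 h2
      obtain ⟨-, hx, hy, -⟩ := key T hT x y h1
      exact hne ((key T' hT' x y h2).2.2.2 T (hF T hT) hx hy)
  · intro x y h
    rw [hmem] at h ⊢
    obtain ⟨T, hT, h⟩ := h
    exact ⟨T, hT, by tauto⟩
  · intro x y h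
    obtain ⟨T, hT, h⟩ := (hmem x y).1 h
    obtain ⟨hne, hx, hy, -⟩ := key T hT x y h
    exact ⟨(hF T hT).isClique hx hy hne, T, hT, hx, hy⟩
  · intro x y z hxy hyz hxz
    rw [hmem] at hxy hyz hxz
    obtain ⟨T1, hT1, h1⟩ := hxy
    obtain ⟨T2, hT2, h2⟩ := hyz
    obtain ⟨T3, hT3, h3⟩ := hxz
    obtain ⟨n1, x1, y1, k1⟩ := key T1 hT1 x y h1
    obtain ⟨n2, y2, z2, k2⟩ := key T2 hT2 y z h2
    obtain ⟨n3, x3, z3, k3⟩ := key T3 hT3 x z h3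
    have hT : G.IsNClique 3 {x, y, z} := SimpleGraph.is3Clique_iff.2 ⟨x, y, z,
      (hF T1 hT1).isClique x1 y1 n1, (hF T3 hT3).isClique x3 z3 n3,
      (hF T2 hT2).isClique y2 z2 n2, rfl⟩
    have e1 := k1 _ hT (by simp) (by simp)
    have e2 := k2 _ hT (by simp) (by simp)
    have e3 := k3 _ hT (by simp) (by simp)
    subst e1
    rw [← e2] at h2
    rw [← e3] at h3
    simp only [mem_erase] at h1 h2 h3
    grind

section Counting

variable [Fintype V] [DecidableRel G.Adj]

/-- If no 4-clique exists, there are at most `n² / 8` triangles. -/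
theorem HatFree.eight_mul_card_le_sq (hG : HatFree G) (hK : ∀ Q, ¬ G.IsNClique 4 Q) :
    8 * #(G.cliqueFinset 3) ≤ Fintype.card V ^ 2 := by
  obtain ⟨S, hS, hsymm, -, htri⟩ := hG.exists_triangleFree_pairs (G.cliqueFinset 3)
    (fun T hT => SimpleGraph.mem_cliqueFinset_iff.1 hT) (fun T _ Q hQ => absurd hQ (hK Q))
  have := two_mul_sum_adj_le_sq (fun x y => (x, y) ∈ S) hsymm htri univ
  rw [← sum_product', univ_product_univ, sum_boole, card_univ] at this
  simp only [Prod.mk.eta, filter_univ_mem, Nat.cast_id] at this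
  omega

/-- The bound on triangles when there is exactly one 4-clique, in terms of the number of vertices
outside it. -/
theorem HatFree.eight_mul_card_le_of_unique (hG : HatFree G) {Q : Finset V}
    (hQ : G.IsNClique 4 Q) (hK : ∀ Q', G.IsNClique 4 Q' → Q' = Q) :
    8 * #(G.cliqueFinset 3) ≤ 32 + 4 * #Qᶜ + #Qᶜ ^ 2 := by
  obtain ⟨S, hS, hsymm, hadj, htri⟩ := hG.exists_triangleFree_pairs
    {T ∈ G.cliqueFinset 3 | ¬ T ⊆ Q}
    (fun T hT => SimpleGraph.mem_cliqueFinset_iff.1 (mem_filter.1 hT).1)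
    (fun T hT Q' hQ' => hK Q' hQ' ▸ (mem_filter.1 hT).2)
  have hin : #{T ∈ G.cliqueFinset 3 | T ⊆ Q} ≤ 4 := by
    refine (card_le_card (t := Q.powersetCard 3) fun T hT => ?_).trans
      (by rw [card_powersetCard, hQ.card_eq]; rfl)
    rw [mem_filter, SimpleGraph.mem_cliqueFinset_iff] at hT
    exact mem_powersetCard.2 ⟨hT.2, hT.1.card_eq⟩
  have hsplit := card_filter_add_card_filter_not (s := G.cliqueFinset 3) (fun T => T ⊆ Q)
  have hM := two_mul_sum_adj_le_sq (fun x y => (x, y) ∈ S) hsymm htri Qᶜ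
  have hone : ∀ x ∈ Qᶜ, ∑ y ∈ Q, (if (x, y) ∈ S then 1 else 0) ≤ 1 := by
    intro x hx
    rw [sum_boole, Nat.cast_id, card_le_one]
    intro y hy z hz
    rw [mem_filter] at hy hz
    exact hG.eq_of_adj_of_adj hQ (mem_compl.1 hx) hy.1 hz.1 (hadj _ _ hy.2).1 (hadj _ _ hz.2).1
  have hcross : ∑ x ∈ Qᶜ, ∑ y ∈ Q, (if (x, y) ∈ S then 1 else 0) ≤ #Qᶜ := by
    rw [card_eq_sum_ones]
    exact sum_le_sum hone
  have hcross' : ∑ x ∈ Q, ∑ y ∈ Qᶜ, (if (x, y) ∈ S then 1 else 0) =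
      ∑ x ∈ Qᶜ, ∑ y ∈ Q, (if (x, y) ∈ S then 1 else 0) := by
    rw [sum_comm]
    refine sum_congr rfl fun x _ => sum_congr rfl fun y _ => ?_
    simp only [show (y, x) ∈ S ↔ (x, y) ∈ S from ⟨hsymm y x, hsymm x y⟩]
  have hzero : ∑ x ∈ Q, ∑ y ∈ Q, (if (x, y) ∈ S then 1 else 0) = 0 := by
    refine sum_eq_zero fun x hx => sum_eq_zero fun y hy => if_neg fun hxy => ?_
    obtain ⟨xy, T, hT, hxT, hyT⟩ := hadj x y hxy
    rw [mem_filter, SimpleGraph.mem_cliqueFinset_iff] at hT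
    exact hT.2 (hG.subset_of_mem hQ hT.1 xy.ne hxT hyT hx hy)
  have htot : ∑ x, ∑ y, (if (x, y) ∈ S then 1 else 0) = #S := by
    rw [← sum_product', univ_product_univ, sum_boole]
    simp
  simp only [← sum_add_sum_compl Q, sum_add_distrib] at htot
  omega

theorem card_cliqueFinset_three_le_add {Q Q' : Finset V} (hQ : #Q = 4) (hQ' : #Q' = 4)
    {E : Finset (Finset V)} (hE : ∀ T, G.IsNClique 3 T → ¬ T ⊆ Q → ¬ T ⊆ Q' → T ∈ E) :
    #(G.cliqueFinset 3) ≤ 8 + #E := by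
  have hsub : G.cliqueFinset 3 ⊆ (Q.powersetCard 3 ∪ Q'.powersetCard 3) ∪ E := by
    intro T hT
    rw [SimpleGraph.mem_cliqueFinset_iff] at hT
    simp only [mem_union, mem_powersetCard, hT.card_eq, and_true]
    by_contra! h
    exact h.2 (hE T hT h.1.1 h.1.2)
  have h1 := card_le_card hsub
  have h2 := card_union_le (Q.powersetCard 3 ∪ Q'.powersetCard 3) E
  have h3 := card_union_le (Q.powersetCard 3) (Q'.powersetCard 3)
  rw [card_powersetCard, card_powersetCard, hQ, hQ'] at h3
  have : Nat.choose 4 3 = 4 := rfl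
  omega

theorem HatFree.card_le_of_disjoint (hG : HatFree G) (hV : Fintype.card V = 10)
    {Q Q' : Finset V} (hQ : G.IsNClique 4 Q) (hQ' : G.IsNClique 4 Q') (hd : Disjoint Q' Q) :
    #(G.cliqueFinset 3) ≤ 12 := by
  have hU : #(Q' ∪ Q)ᶜ = 2 := by
    rw [card_compl, card_union_of_disjoint hd, hQ.card_eq, hQ'.card_eq, hV]
  obtain ⟨x, y, hxy, hU⟩ := card_eq_two.1 hU
  have hmem : ∀ w, (w ∉ Q' ∧ w ∉ Q) ↔ (w = x ∨ w = y) := by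
    intro w
    have := congrArg (w ∈ ·) hU
    simpa [not_or] using this
  have hx := (hmem x).2 (Or.inl rfl)
  have hy := (hmem y).2 (Or.inr rfl)
  have single : ∀ T, G.IsNClique 3 T → ¬ T ⊆ Q → ¬ T ⊆ Q' → ∀ u v, u ∉ Q → u ∉ Q' →
      (∀ w, (w ∉ Q' ∧ w ∉ Q) → (w = u ∨ w = v)) → u ∈ T → v ∉ T →
      T = insert u ({w ∈ Q | G.Adj u w} ∪ {w ∈ Q' | G.Adj u w}) := by
    intro T hT h h' u v huQ huQ' huv hu hv
    refine eq_of_subset_of_card_le (fun w hw => ?_) ?_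
    · by_cases hwu : w = u
      · simp [hwu]
      · have := hT.isClique hu hw (Ne.symm hwu)
        have := huv w
        simp only [mem_insert, mem_union, mem_filter]
        by_contra! hc
        rcases this ⟨fun h => hc.2.2 h ‹_›, fun h => hc.2.1 h ‹_›⟩ with rfl | rfl
        · exact hwu rfl
        · exact hv hw
    · have one : ∀ P, G.IsNClique 4 P → u ∉ P → #{w ∈ P | G.Adj u w} ≤ 1 := by
        intro P hP huP
        rw [card_le_one]
        intro a ha b hb
        rw [mem_filter] at ha hb
        exact hG.eq_of_adj_of_adj hP huP ha.1 hb.1 ha.2 hb.2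
      have h1 := one Q hQ huQ
      have h2 := one Q' hQ' huQ'
      have h3 := card_union_le {w ∈ Q | G.Adj u w} {w ∈ Q' | G.Adj u w}
      have h4 := card_insert_le u ({w ∈ Q | G.Adj u w} ∪ {w ∈ Q' | G.Adj u w})
      rw [hT.card_eq]
      omega
  refine (card_cliqueFinset_three_le_add (E := {
    insert x ({w ∈ Q | G.Adj x w} ∪ {w ∈ Q' | G.Adj x w}),
    insert y ({w ∈ Q | G.Adj y w} ∪ {w ∈ Q' | G.Adj y w}),
    {x, y} ∪ {w ∈ Q | G.Adj x w}, {x, y} ∪ {w ∈ Q' | G.Adj x w}})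
    hQ.card_eq hQ'.card_eq ?_).trans (Nat.add_le_add_left card_le_four 8)
  intro T hT h h'
  simp only [mem_insert, mem_singleton]
  by_cases hxT : x ∈ T
  · by_cases hyT : y ∈ T
    · obtain ⟨z, hz, hzne⟩ := exists_mem_notMem_of_card_lt_card
        (s := {x, y}) (t := T) (by rw [hT.card_eq]; exact (card_le_two).trans_lt (by norm_num))
      simp only [mem_insert, mem_singleton, not_or] at hzne
      by_cases hzQ : z ∈ Q
      · exact Or.inr (Or.inr (Or.inl (hG.eq_insert_filter hQ hT hx.2 hzQ hxy
          (Ne.symm hzne.2) hxT hyT hz)))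
      · have hzQ' : z ∈ Q' := by
          by_contra hc
          have := (hmem z).1 ⟨hc, hzQ⟩
          tauto
        exact Or.inr (Or.inr (Or.inr (hG.eq_insert_filter hQ' hT hx.1 hzQ' hxy
          (Ne.symm hzne.2) hxT hyT hz)))
    · exact Or.inl (single T hT h h' x y hx.2 hx.1 (fun w => (hmem w).1) hxT hyT)
  · obtain ⟨u, huT, huQ, huQ'⟩ := hG.exists_mem_notMem hQ hQ' hT h h'
    rcases (hmem u).1 ⟨huQ', huQ⟩ with rfl | rfl
    · exact absurd huT hxT
    · exact Or.inr (Or.inl (single T hT h h' u x huQ huQ' (fun w hw => ((hmem w).1 hw).symm)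
        huT hxT))

theorem HatFree.card_le_of_inter (hG : HatFree G) (hV : Fintype.card V = 10)
    {Q Q' : Finset V} (hQ : G.IsNClique 4 Q) (hQ' : G.IsNClique 4 Q') (hi : #(Q' ∩ Q) = 1) :
    #(G.cliqueFinset 3) ≤ 12 := by
  have hU : #(Q' ∪ Q)ᶜ = 3 := by
    have := card_union_add_card_inter Q' Q
    rw [hQ.card_eq, hQ'.card_eq] at this
    rw [card_compl, hV]
    omega
  set U := (Q' ∪ Q)ᶜ
  have hmem : ∀ w, w ∈ U ↔ (w ∉ Q' ∧ w ∉ Q) := by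
    intro w
    simp [U]
  obtain ⟨i, hi⟩ := card_eq_one.1 hi
  have hiQ : i ∈ Q' ∧ i ∈ Q := by
    rw [← mem_inter, hi, mem_singleton]
  -- a triangle inside neither 4-clique has two vertices outside both
  have two : ∀ T, G.IsNClique 3 T → ¬ T ⊆ Q → ¬ T ⊆ Q' →
      ∃ u ∈ U, ∃ v ∈ U, u ≠ v ∧ u ∈ T ∧ v ∈ T := by
    intro T hT h h'
    obtain ⟨u, huT, huQ, huQ'⟩ := hG.exists_mem_notMem hQ hQ' hT h h'
    obtain ⟨p, q, hpq, hT'⟩ := card_eq_two.1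
      (show #(T.erase u) = 2 by rw [card_erase_of_mem huT, hT.card_eq])
    have hp : p ≠ u ∧ p ∈ T := by rw [← mem_erase, hT']; simp
    have hq : q ≠ u ∧ q ∈ T := by rw [← mem_erase, hT']; simp
    by_contra! hc
    have hc' := fun v hv huv hvT => hc u ((hmem u).2 ⟨huQ', huQ⟩) v hv huv huT hvT
    have hpU : ¬ p ∈ U := fun h => hc' p h hp.1.symm hp.2
    have hqU : ¬ q ∈ U := fun h => hc' q h hq.1.symm hq.2
    rw [hmem, not_and_or, not_not, not_not] at hpU hqU
    have cross : ∀ p q, p ≠ q → p ∈ T → q ∈ T → p ∈ Q → q ∈ Q' → False := by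
      intro p q hpq hp hq hpQ hqQ'
      have hqQ : q ∉ Q := fun hqQ => h (hG.subset_of_mem hQ hT hpq hp hq hpQ hqQ)
      have hpi : p = i := hG.eq_of_adj_of_adj hQ hqQ hpQ hiQ.2 (hT.isClique hq hp hpq.symm)
        (hQ'.isClique hqQ' hiQ.1 (fun h => hqQ (h ▸ hiQ.2)))
      exact h' (hG.subset_of_mem hQ' hT hpq hp hq (hpi ▸ hiQ.1) hqQ')
    rcases hpU with hpU | hpU <;> rcases hqU with hqU | hqU
    · exact h' (hG.subset_of_mem hQ' hT hpq hp.2 hq.2 hpU hqU)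
    · exact cross q p hpq.symm hq.2 hp.2 hqU hpU
    · exact cross p q hpq hp.2 hq.2 hpU hqU
    · exact h (hG.subset_of_mem hQ hT hpq hp.2 hq.2 hpU hqU)
  have third : ∀ T, G.IsNClique 3 T → T ≠ U → ∀ u ∈ U, ∀ v ∈ U, u ≠ v → u ∈ T → v ∈ T →
      T = {u, v} ∪ {w ∈ Q | G.Adj u w} ∨ T = {u, v} ∪ {w ∈ Q' | G.Adj u w} := by
    intro T hT hTU u hu v hv huv huT hvT
    have : ¬ T ⊆ U := fun h => hTU (eq_of_subset_of_card_le h (by rw [hU, hT.card_eq]))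
    obtain ⟨z, hz, hzU⟩ := not_subset.1 this
    have hvz : v ≠ z := fun h => hzU (h ▸ hv)
    rw [hmem, not_and_or, not_not, not_not] at hzU
    rcases hzU with hzQ | hzQ
    · exact Or.inr (hG.eq_insert_filter hQ' hT ((hmem u).1 hu).1 hzQ huv hvz huT hvT hz)
    · exact Or.inl (hG.eq_insert_filter hQ hT ((hmem u).1 hu).2 hzQ huv hvz huT hvT hz)
  suffices h : ∃ E : Finset (Finset V), #E ≤ 4 ∧
      ∀ T, G.IsNClique 3 T → ¬ T ⊆ Q → ¬ T ⊆ Q' → T ∈ E by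
    obtain ⟨E, hE, h⟩ := h
    exact (card_cliqueFinset_three_le_add hQ.card_eq hQ'.card_eq h).trans
      (Nat.add_le_add_left hE 8)
  by_cases hUc : G.IsNClique 3 U
  · by_cases hK : ∃ P, G.IsNClique 4 P ∧ U ⊆ P
    · obtain ⟨P, hP, hUP⟩ := hK
      refine ⟨P.powersetCard 3, by rw [card_powersetCard, hP.card_eq]; rfl,
        fun T hT h h' => ?_⟩
      obtain ⟨u, hu, v, hv, huv, huT, hvT⟩ := two T hT h h'
      exact mem_powersetCard.2
        ⟨hG.subset_of_mem hP hT huv huT hvT (hUP hu) (hUP hv), hT.card_eq⟩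
    · push Not at hK
      obtain ⟨a, ha, hapex⟩ := hG.exists_apex hUc hK
      obtain ⟨b, c, hbc, hUe⟩ := card_eq_two.1
        (show #(U.erase a) = 2 by rw [card_erase_of_mem ha, hU])
      have hb : b ≠ a ∧ b ∈ U := by rw [← mem_erase, hUe]; simp
      have hc : c ≠ a ∧ c ∈ U := by rw [← mem_erase, hUe]; simp
      refine ⟨{U, {b, c} ∪ {w ∈ Q | G.Adj b w}, {b, c} ∪ {w ∈ Q' | G.Adj b w}},
        card_le_three.trans (by norm_num), fun T hT h h' => ?_⟩
      simp only [mem_insert, mem_singleton]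
      by_cases hTU : T = U
      · exact Or.inl hTU
      refine Or.inr (third T hT hTU b hb.2 c hc.2 hbc ?_ ?_) <;>
      · obtain ⟨u, hu, v, hv, huv, huT, hvT⟩ := two T hT h h'
        have hua : u ≠ a := by
          rintro rfl
          exact hTU (hapex v hv huv.symm T hT huT hvT)
        have hva : v ≠ a := by
          rintro rfl
          exact hTU (hapex u hu huv T hT hvT huT)
        have hu' : u ∈ U.erase a := mem_erase.2 ⟨hua, hu⟩
        have hv' : v ∈ U.erase a := mem_erase.2 ⟨hva, hv⟩
        rw [hUe, mem_insert, mem_singleton] at hu' hv'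
        grind
  · obtain ⟨u, hu, w, hw, huw, hnadj⟩ : ∃ u ∈ U, ∃ w ∈ U, u ≠ w ∧ ¬ G.Adj u w := by
      by_contra! hc
      exact hUc ⟨fun u hu w hw huw => hc u hu w hw huw, hU⟩
    obtain ⟨v, hv⟩ := card_eq_one.1 (show #((U.erase u).erase w) = 1 by
      rw [card_erase_of_mem (mem_erase.2 ⟨huw.symm, hw⟩), card_erase_of_mem hu, hU])
    have hv' : v ≠ w ∧ v ≠ u ∧ v ∈ U := by
      rw [← mem_erase, ← mem_erase, hv, mem_singleton]
    have hUmem : ∀ x ∈ U, x = u ∨ x = v ∨ x = w := by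
      intro x hx
      by_contra! hc
      have : x ∈ (U.erase u).erase w := by simp [hx, hc]
      rw [hv, mem_singleton] at this
      exact hc.2.1 this
    refine ⟨{{v, u} ∪ {x ∈ Q | G.Adj v x}, {v, u} ∪ {x ∈ Q' | G.Adj v x},
      {v, w} ∪ {x ∈ Q | G.Adj v x}, {v, w} ∪ {x ∈ Q' | G.Adj v x}}, card_le_four,
      fun T hT h h' => ?_⟩
    simp only [mem_insert, mem_singleton]
    have hTU : T ≠ U := by
      rintro rfl
      exact hUc hT
    obtain ⟨x, hx, y, hy, hxy, hxT, hyT⟩ := two T hT h h'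
    have hnot : ¬ (u ∈ T ∧ w ∈ T) := fun ⟨h1, h2⟩ => hnadj (hT.isClique h1 h2 huw)
    have hcase : (v ∈ T ∧ u ∈ T) ∨ (v ∈ T ∧ w ∈ T) := by
      have := hUmem x hx
      have := hUmem y hy
      grind
    rcases hcase with ⟨h1, h2⟩ | ⟨h1, h2⟩
    · have := third T hT hTU v hv'.2.2 u hu hv'.2.1 h1 h2
      tauto
    · have := third T hT hTU v hv'.2.2 w hw hv'.1 h1 h2
      tauto

theorem HatFree.card_cliqueFinset_three_le (hG : HatFree G) (hV : Fintype.card V = 10) :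
    #(G.cliqueFinset 3) ≤ 12 := by
  by_cases hK : ∃ Q, G.IsNClique 4 Q
  · obtain ⟨Q, hQ⟩ := hK
    by_cases hK' : ∃ Q', G.IsNClique 4 Q' ∧ Q' ≠ Q
    · obtain ⟨Q', hQ', hne⟩ := hK'
      rcases Nat.le_one_iff_eq_zero_or_eq_one.1 (hG.card_inter_le_one_of_ne hQ hQ' hne) with h | h
      · exact hG.card_le_of_disjoint hV hQ hQ' (disjoint_iff_inter_eq_empty.2 (card_eq_zero.1 h))
      · exact hG.card_le_of_inter hV hQ hQ' h
    · push Not at hK'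
      have := hG.eight_mul_card_le_of_unique hQ hK'
      rw [card_compl, hV, hQ.card_eq] at this
      omega
  · push Not at hK
    have := hG.eight_mul_card_le_sq hK
    rw [hV] at this
    omega

end Counting

end Structure

/-- Every `10`-vertex graph with at least `13` triangles contains `P̂₄` as a subgraph. -/
theorem stmt_8 {V : Type} [Fintype V] (G : SimpleGraph V)
    (hcard : Fintype.card V = 10) (ht : 13 ≤ triangleCount G) :
    Contains hatP4 G := by
  classical
  by_contra h
  have := (hatFree_of_not_contains h).card_cliqueFinset_three_le hcard
  rw [triangleCount, ← SimpleGraph.coe_cliqueFinset, Set.ncard_coe_finset] at ht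
  omega
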